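/- arXiv:2507.05642 — 2 statements merged into one kernel-verified Lean document; each statement's English description precedes it below -/
import Mathlib

section
/- For every ℓ ∈ {2,3,4,5,6,7,8}, there exists a QLS(4) in ℋ_2⊗ℋ_2 having exactly ℓ distinct entries (up to global phase) that appear neither in H₀ nor in H₁, where H₀ is the block QLS(4) (A₀,B₀;B₀,A₀) and H₁ = (A₀,B₀;B₁,A₁). -/
noncomputable section

/-- Two vectors are identified when they differ by a global phase `e^{iθ}`. -/
def PhaseEq {E : Type*} [AddCommGroup E] [Module ℂ E] (u v : E) : Prop :=
  ∃ θ : ℝ, u = Complex.exp (θ * Complex.I) • v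

/-- `ℋ₂ ⊗ ℋ₂`, with orthonormal basis `|00⟩, |01⟩, |10⟩, |11⟩`. -/
abbrev H4 := EuclideanSpace ℂ (Fin 4)

/-- `|00⟩, |01⟩, |10⟩, |11⟩` (in this order). -/
def e4 : Fin 4 → H4 := fun i => EuclideanSpace.single i 1

/-- The 2×2 array `A_a` built on `|00⟩, |01⟩`. -/
def Aarr (a : ℝ) : Fin 2 → Fin 2 → H4 := fun i j =>
  ((Real.sqrt (1 + a ^ 2) : ℝ)⁻¹ : ℂ) •
    (if i = j then e4 0 + (a : ℂ) • e4 1 else (-(a : ℂ)) • e4 0 + e4 1)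

/-- The 2×2 array `B_a` built on `|10⟩, |11⟩`. -/
def Barr (a : ℝ) : Fin 2 → Fin 2 → H4 := fun i j =>
  ((Real.sqrt (1 + a ^ 2) : ℝ)⁻¹ : ℂ) •
    (if i = j then e4 2 + (a : ℂ) • e4 3 else (-(a : ℂ)) • e4 2 + e4 3)

/-- A quantum Latin square of order 4: rows and columns are orthonormal bases. -/
def IsQLS4 (M : Fin 4 → Fin 4 → H4) : Prop :=
  (∀ i, Orthonormal ℂ (fun j => M i j)) ∧ (∀ j, Orthonormal ℂ (fun i => M i j))

/-- `(P, Q; R, S)` as a 4×4 block matrix. -/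
def blockQLS (P Q R S : Fin 2 → Fin 2 → H4) : Fin 4 → Fin 4 → H4 := fun i j =>
  Matrix.reindex finSumFinEquiv finSumFinEquiv
    (Matrix.fromBlocks (Matrix.of P) (Matrix.of Q) (Matrix.of R) (Matrix.of S)) i j

/-- `H₀ = (A₀, B₀; B₀, A₀)`. -/
def H0 : Fin 4 → Fin 4 → H4 := blockQLS (Aarr 0) (Barr 0) (Barr 0) (Aarr 0)

/-- `H₁ = (A₀, B₀; B₁, A₁)`. -/
def H1 : Fin 4 → Fin 4 → H4 := blockQLS (Aarr 0) (Barr 0) (Barr 1) (Aarr 1)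

/-- `M` has exactly `ℓ` distinct entries (up to global phase) appearing
neither in `N₀` nor in `N₁`. -/
def NewEntryCount (M N₀ N₁ : Fin 4 → Fin 4 → H4) (ℓ : ℕ) : Prop :=
  ∃ reps : Fin ℓ → H4,
    (∀ k l, k ≠ l → ¬ PhaseEq (reps k) (reps l)) ∧
    (∀ k, (∃ i j, PhaseEq (reps k) (M i j)) ∧
      (∀ i j, ¬ PhaseEq (reps k) (N₀ i j)) ∧
      (∀ i j, ¬ PhaseEq (reps k) (N₁ i j))) ∧
    (∀ i j, (∀ i' j', ¬ PhaseEq (M i j) (N₀ i' j')) →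
      (∀ i' j', ¬ PhaseEq (M i j) (N₁ i' j')) →
      ∃ k, PhaseEq (M i j) (reps k))

/-- The vector of `ℋ₂ ⊗ ℋ₂` whose coordinates are the given integers divided by `325`. -/
def intVec (v : Fin 4 → ℤ) : H4 := WithLp.toLp 2 fun i => (v i : ℂ) / 325

lemma PhaseEq.refl {E : Type*} [AddCommGroup E] [Module ℂ E] (u : E) : PhaseEq u u :=
  ⟨0, by simp⟩

lemma PhaseEq.minor_eq {u v : H4} (h : PhaseEq u v) (i j : Fin 4) : u i * v j = u j * v i := by
  obtain ⟨θ, rfl⟩ := h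
  simp only [PiLp.smul_apply, smul_eq_mul]
  ring

lemma PhaseEq.mul_eq_zero {u v : H4} (h : PhaseEq u v) {i j : Fin 4} (hv : v i * v j = 0) :
    u i * u j = 0 := by
  obtain ⟨θ, rfl⟩ := h
  simp only [PiLp.smul_apply, smul_eq_mul]
  linear_combination (Complex.exp (θ * Complex.I)) ^ 2 * hv

lemma orthonormal_intVec {ι : Type*} [DecidableEq ι] {f : ι → Fin 4 → ℤ}
    (hf : ∀ j k, ∑ m, f j m * f k m = if j = k then 325 ^ 2 else 0) :
    Orthonormal ℂ fun j => intVec (f j) := by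
  rw [orthonormal_iff_ite]
  intro j k
  have h := congrArg (Int.cast : ℤ → ℂ) (hf j k)
  rw [apply_ite Int.cast] at h
  push_cast at h
  calc inner ℂ (intVec (f j)) (intVec (f k))
      = (∑ m, (f j m : ℂ) * f k m) / 325 ^ 2 := by
        rw [PiLp.inner_apply, Finset.sum_div]
        refine Finset.sum_congr rfl fun m _ => ?_
        simp only [intVec, RCLike.inner_apply, map_div₀, map_intCast, map_ofNat]
        ring
    _ = if j = k then 1 else 0 := by
        rw [h]
        split_ifs <;> norm_num

/-- Entries of a block array `(A_a, B_b; B_c, A_d)` never mix `|01⟩` and `|10⟩`. -/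
lemma blockQLS_apply_one_mul_apply_two (a b c d : ℝ) (i j : Fin 4) :
    blockQLS (Aarr a) (Barr b) (Barr c) (Aarr d) i j 1 *
      blockQLS (Aarr a) (Barr b) (Barr c) (Aarr d) i j 2 = 0 := by
  obtain ⟨i, rfl⟩ := (finSumFinEquiv (m := 2) (n := 2)).surjective i
  obtain ⟨j, rfl⟩ := (finSumFinEquiv (m := 2) (n := 2)).surjective j
  unfold blockQLS
  rcases i with i | i <;> rcases j with j | j <;>
    simp only [Matrix.reindex_apply, Matrix.submatrix_apply, Equiv.symm_apply_apply,
      Matrix.fromBlocks_apply₁₁, Matrix.fromBlocks_apply₁₂, Matrix.fromBlocks_apply₂₁,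
      Matrix.fromBlocks_apply₂₂, Matrix.of_apply, Aarr, Barr] <;>
    split_ifs <;> simp [e4]

lemma H0_zero_zero : H0 0 0 = intVec ![325, 0, 0, 0] := by
  have h : H0 0 0 = Aarr 0 0 0 := rfl
  rw [h]
  ext m
  fin_cases m <;> simp [Aarr, e4, intVec]

lemma H0_zero_three : H0 0 3 = intVec ![0, 0, 0, 325] := by
  have h : H0 0 3 = Barr 0 0 1 := rfl
  rw [h]
  ext m
  fin_cases m <;> simp [Barr, e4, intVec]

/-- An integer array certifies a QLS(4) with `ℓ` new entries, found at the positions `pos`. -/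
lemma exists_qls4_of_int {ℓ : ℕ} (N : Fin 4 → Fin 4 → Fin 4 → ℤ) (pos : Fin ℓ → Fin 4 × Fin 4)
    (hrow : ∀ i j k, ∑ m, N i j m * N i k m = if j = k then 325 ^ 2 else 0)
    (hcol : ∀ i j k, ∑ m, N j i m * N k i m = if j = k then 325 ^ 2 else 0)
    (hdist : ∀ k l, k ≠ l → ∃ m n, N (pos k).1 (pos k).2 m * N (pos l).1 (pos l).2 n ≠
      N (pos k).1 (pos k).2 n * N (pos l).1 (pos l).2 m)
    (hnew : ∀ k, N (pos k).1 (pos k).2 1 * N (pos k).1 (pos k).2 2 ≠ 0)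
    (hcover : ∀ i j, N i j = ![325, 0, 0, 0] ∨ N i j = ![0, 0, 0, 325] ∨
      ∃ k, N i j = N (pos k).1 (pos k).2) :
    ∃ M : Fin 4 → Fin 4 → H4, IsQLS4 M ∧ NewEntryCount M H0 H1 ℓ := by
  have hold (k : Fin ℓ) (a b c d : ℝ) (i j : Fin 4) : ¬ PhaseEq
      (intVec (N (pos k).1 (pos k).2)) (blockQLS (Aarr a) (Barr b) (Barr c) (Aarr d) i j) := by
    intro h
    have h0 := h.mul_eq_zero (blockQLS_apply_one_mul_apply_two a b c d i j)
    simp only [intVec] at h0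
    refine hnew k ?_
    field_simp at h0
    exact_mod_cast h0
  refine ⟨fun i j => intVec (N i j), ⟨fun i => orthonormal_intVec (hrow i),
    fun i => orthonormal_intVec (hcol i)⟩, fun k => intVec (N (pos k).1 (pos k).2), ?_, ?_, ?_⟩
  · intro k l hkl h
    obtain ⟨m, n, hmn⟩ := hdist k l hkl
    have h0 := h.minor_eq m n
    simp only [intVec] at h0
    refine hmn ?_
    field_simp at h0
    exact_mod_cast h0
  · exact fun k => ⟨⟨_, _, PhaseEq.refl _⟩, hold k _ _ _ _, hold k _ _ _ _⟩
  · intro i j h0 _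
    beta_reduce at h0 ⊢
    rcases hcover i j with h | h | ⟨k, h⟩
    · exact absurd (by rw [h, H0_zero_zero]; exact PhaseEq.refl _) (h0 0 0)
    · exact absurd (by rw [h, H0_zero_three]; exact PhaseEq.refl _) (h0 0 3)
    · exact ⟨k, by rw [h]; exact PhaseEq.refl _⟩

/-- The 2×2 array on `|00⟩` and `p = (3|01⟩ + 4|10⟩)/5`, rotated by the angle with cosine
`z.1 / 65` and sine `z.2 / 65`, in the coordinates of `intVec`. -/
def upperBlock (z : ℤ × ℤ) : Fin 2 → Fin 2 → Fin 4 → ℤ := fun i j =>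
  if i = j then ![5 * z.1, 3 * z.2, 4 * z.2, 0] else ![-5 * z.2, 3 * z.1, 4 * z.1, 0]

/-- The 2×2 array on `|11⟩` and `q = (4|01⟩ - 3|10⟩)/5`, rotated by the angle with cosine
`z.1 / 65` and sine `z.2 / 65`, in the coordinates of `intVec`. -/
def lowerBlock (z : ℤ × ℤ) : Fin 2 → Fin 2 → Fin 4 → ℤ := fun i j =>
  if i = j then ![0, 4 * z.2, -3 * z.2, 5 * z.1] else ![0, 4 * z.1, -3 * z.1, -5 * z.2]

/-- The block array with upper blocks on the diagonal (angles `z`, `z₁`) and lower blocks off it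
(angles `w`, `w₁`). -/
def rotatedArray (z z₁ w w₁ : ℤ × ℤ) : Fin 4 → Fin 4 → Fin 4 → ℤ := fun i j =>
  Matrix.fromBlocks (Matrix.of (upperBlock z)) (Matrix.of (lowerBlock w))
    (Matrix.of (lowerBlock w₁)) (Matrix.of (upperBlock z₁))
    (finSumFinEquiv.symm i) (finSumFinEquiv.symm j)

/-- For every `ℓ ∈ {2,…,8}` there is a QLS(4) in `ℋ₂ ⊗ ℋ₂` with exactly `ℓ`
distinct entries (up to global phase) appearing neither in `H₀` nor in `H₁`. -/
theorem exists_qls4_new_entries :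
    ∀ ℓ ∈ ({2, 3, 4, 5, 6, 7, 8} : Set ℕ),
      ∃ M : Fin 4 → Fin 4 → H4, IsQLS4 M ∧ NewEntryCount M H0 H1 ℓ := by
  rintro ℓ (rfl | rfl | rfl | rfl | rfl | rfl | rfl)
  · refine exists_qls4_of_int (rotatedArray (65, 0) (65, 0) (65, 0) (65, 0))
      ![(0, 1), (0, 3)]
      ?_ ?_ ?_ ?_ ?_ <;> decide
  · refine exists_qls4_of_int (rotatedArray (65, 0) (65, 0) (39, 52) (39, 52))
      ![(0, 1), (0, 2), (0, 3)]
      ?_ ?_ ?_ ?_ ?_ <;> decide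
  · refine exists_qls4_of_int (rotatedArray (39, 52) (39, 52) (39, 52) (39, 52))
      ![(0, 0), (0, 1), (0, 2), (0, 3)]
      ?_ ?_ ?_ ?_ ?_ <;> decide
  · refine exists_qls4_of_int (rotatedArray (65, 0) (65, 0) (39, 52) (25, 60))
      ![(0, 1), (0, 2), (0, 3), (2, 0), (2, 1)]
      ?_ ?_ ?_ ?_ ?_ <;> decide
  · refine exists_qls4_of_int (rotatedArray (39, 52) (39, 52) (39, 52) (25, 60))
      ![(0, 0), (0, 1), (0, 2), (0, 3), (2, 0), (2, 1)]
      ?_ ?_ ?_ ?_ ?_ <;> decide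
  · refine exists_qls4_of_int (rotatedArray (65, 0) (39, 52) (39, 52) (25, 60))
      ![(0, 1), (0, 2), (0, 3), (2, 0), (2, 1), (2, 2), (2, 3)]
      ?_ ?_ ?_ ?_ ?_ <;> decide
  · refine exists_qls4_of_int (rotatedArray (39, 52) (25, 60) (39, 52) (25, 60))
      ![(0, 0), (0, 1), (0, 2), (0, 3), (2, 0), (2, 1), (2, 2), (2, 3)]
      ?_ ?_ ?_ ?_ ?_ <;> decide
end
end

section
/- For any integer m ≥ 2 and any integer c with 4m ≤ c ≤ 16m² and c ≠ 4m+1, there exists a quantum Latin square of order 4m over ℋ_m⊗ℋ₂⊗ℋ₂ with cardinality exactly c. -/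
noncomputable section

/-- Concrete tensor product `u ⊗ v` of Euclidean space vectors. -/
def tens {ι κ : Type*} (u : EuclideanSpace ℂ ι) (v : EuclideanSpace ℂ κ) :
    EuclideanSpace ℂ (ι × κ) :=
  (WithLp.equiv 2 _).symm (fun p : ι × κ => u p.1 * v p.2)

/-- An array (with arbitrary index types) all of whose rows and columns
are orthonormal families. -/
def IsQLSIdx {ι κ E : Type*} [NormedAddCommGroup E] [InnerProductSpace ℂ E]
    (M : ι → κ → E) : Prop :=
  (∀ i, Orthonormal ℂ (fun j => M i j)) ∧ (∀ j, Orthonormal ℂ (fun i => M i j))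

/-- The family `f` has exactly `c` distinct members up to global phase. -/
def FamCardEq {ι E : Type*} [AddCommGroup E] [Module ℂ E] (f : ι → E) (c : ℕ) : Prop :=
  ∃ reps : Fin c → E,
    (∀ i, ∃ k, PhaseEq (f i) (reps k)) ∧
    (∀ k, ∃ i, PhaseEq (f i) (reps k)) ∧
    (∀ k l, k ≠ l → ¬ PhaseEq (reps k) (reps l))

/-- Coordinates of a vector of `ℋ₂ ⊗ ℋ₂`. -/
abbrev Qubits := Fin 2 × Fin 2

/-- A `4 × 4` array of rational vectors. -/
abbrev RatArray := Qubits → Qubits → Qubits → ℚ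

/-- The bilinear product of two rational vectors. -/
def ratDot (u v : Qubits → ℚ) : ℚ := ∑ y, u y * v y

/-- The orthogonal basis `(1, t), (-t, 1)` of the plane, with `t = 2` or `t = 1`. -/
def planeBasis (s : Bool) (x y : Fin 2) : ℚ :=
  if x = y then 1 else if x = 0 then (if s then 2 else 1) else (if s then -2 else -1)

/-- The array whose entries are products of vectors of plane bases; the flags tell whether the
basis of the first factor depends on the column and that of the second factor on the row. -/
def productArray (f g : Bool) : RatArray := fun r c y =>
  planeBasis (f && c.2 == 1) (r.1 + c.1) y.1 * planeBasis (g && r.1 == 1) (r.2 + c.2) y.2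

/-- The reflection in `w`, scaled by the squared length of `w`. -/
def scaledReflection (w v : Qubits → ℚ) : Qubits → ℚ := fun y =>
  ratDot w w * v y - 2 * ratDot w v * w y

/-- Scale every entry so that its first coordinate becomes `1`. -/
def projectivize (T : RatArray) : RatArray := fun r c y => T r c y / T r c (0, 0)

/-- The image of a product array under a reflection. -/
def reflectedArray (f g : Bool) (a b c d : ℚ) : RatArray :=
  projectivize fun i j =>
    scaledReflection (fun y => (![![a, b], ![c, d]] : Fin 2 → Fin 2 → ℚ) y.1 y.2)
      (productArray f g i j)

/-- Orthogonal rows and columns, with entries normalized by their first coordinate and with nonzero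
second coordinate. -/
structure IsRatQLS (T : RatArray) : Prop where
  row : ∀ r c c', c ≠ c' → ratDot (T r c) (T r c') = 0
  col : ∀ c r r', r ≠ r' → ratDot (T r c) (T r' c) = 0
  first : ∀ r c, T r c (0, 0) = 1
  second : ∀ r c, T r c (0, 1) ≠ 0

instance (T : RatArray) : Decidable (IsRatQLS T) :=
  decidable_of_iff
    ((∀ r c c', c ≠ c' → ratDot (T r c) (T r c') = 0) ∧
      (∀ c r r', r ≠ r' → ratDot (T r c) (T r' c) = 0) ∧
      (∀ r c, T r c (0, 0) = 1) ∧ ∀ r c, T r c (0, 1) ≠ 0)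
    ⟨fun h => ⟨h.1, h.2.1, h.2.2.1, h.2.2.2⟩, fun h => ⟨h.row, h.col, h.first, h.second⟩⟩

/-- The set of entries of an array. -/
def entries (T : RatArray) : Finset (Qubits → ℚ) :=
  Finset.univ.image fun p : Qubits × Qubits => T p.1 p.2

/-- Two rational quantum Latin squares with exactly `p` entries altogether. -/
def IsPairCard (p : ℕ) : Prop :=
  ∃ A B : RatArray, IsRatQLS A ∧ IsRatQLS B ∧ (entries A ∪ entries B).card = p

lemma isRatQLS_full : IsRatQLS (projectivize (productArray true true)) := by decide +kernel

lemma card_entries_full : (entries (projectivize (productArray true true))).card = 16 := by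
  decide +kernel

lemma isPairCard_of_reflection (f g f' g' : Bool) (a b c d : ℚ) {p : ℕ}
    (h : IsRatQLS (projectivize (productArray f g)) ∧ IsRatQLS (reflectedArray f' g' a b c d) ∧
      (entries (projectivize (productArray f g)) ∪
        entries (reflectedArray f' g' a b c d)).card = p) : IsPairCard p :=
  ⟨_, _, h⟩

lemma isPairCard_of_mem {p : ℕ}
    (hp : p ∈ ({4, 6, 7, 11, 12, 14, 23, 24, 26, 28, 30, 31, 32} : Finset ℕ)) :
    IsPairCard p := by
  simp only [Finset.mem_insert, Finset.mem_singleton] at hp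
  rcases hp with rfl | rfl | rfl | rfl | rfl | rfl | rfl | rfl | rfl | rfl | rfl | rfl | rfl
  · exact isPairCard_of_reflection false false false false 1 1 0 0 (by decide +kernel)
  · exact isPairCard_of_reflection false false false false 2 2 1 1 (by decide +kernel)
  · exact isPairCard_of_reflection false false false false 2 1 1 0 (by decide +kernel)
  · exact isPairCard_of_reflection false true false false 2 1 1 0 (by decide +kernel)
  · exact isPairCard_of_reflection false true false false 1 0 0 0 (by decide +kernel)
  · exact isPairCard_of_reflection false true false true 2 2 1 1 (by decide +kernel)
  · exact isPairCard_of_reflection true true false true 1 1 0 1 (by decide +kernel)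
  · exact isPairCard_of_reflection true true false true 1 0 0 0 (by decide +kernel)
  · exact isPairCard_of_reflection true true true true 1 1 0 0 (by decide +kernel)
  · exact isPairCard_of_reflection true true true true 1 0 0 (-1) (by decide +kernel)
  · exact isPairCard_of_reflection true true true true 2 0 0 1 (by decide +kernel)
  · exact isPairCard_of_reflection true true true true 1 0 (-1) 1 (by decide +kernel)
  · exact isPairCard_of_reflection true true true true 1 0 0 0 (by decide +kernel)

lemma exists_sum_eq_of_le (n b R : ℕ) (hR : R ≤ n * b) :
    ∃ r : Fin n → ℕ, (∀ i, r i ≤ b) ∧ ∑ i, r i = R := by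
  induction n generalizing R with
  | zero => exact ⟨fun _ => 0, by simp, by simp at hR; simp [hR]⟩
  | succ n ih =>
    obtain ⟨r, hr, hs⟩ := ih (R - min R b) (by rw [Nat.succ_mul] at hR; omega)
    refine ⟨Fin.cons (min R b) r, Fin.cases (by simp) (by simpa using hr), ?_⟩
    rw [Fin.sum_univ_succ]
    simp only [Fin.cons_zero, Fin.cons_succ, hs]
    omega

lemma exists_pairCard_sum (m : ℕ) (hm : 2 ≤ m) (c : ℕ) (hlo : 4 * m ≤ c) (hhi : c ≤ 32 * m)
    (hne : c ≠ 4 * m + 1) :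
    ∃ p : Fin m → ℕ, (∀ i, IsPairCard (p i)) ∧ ∑ i, p i = c := by
  induction m, hm using Nat.le_induction generalizing c with
  | base =>
    have key : ∀ c ∈ Finset.Icc 8 64, c ≠ 9 →
        ∃ p ∈ ({4, 6, 7, 11, 12, 14, 23, 24, 26, 28, 30, 31, 32} : Finset ℕ),
        ∃ q ∈ ({4, 6, 7, 11, 12, 14, 23, 24, 26, 28, 30, 31, 32} : Finset ℕ), p + q = c := by
      decide +kernel
    obtain ⟨p, hp, q, hq, h⟩ := key c (by simp; omega) hne
    exact ⟨![p, q], by simp [Fin.forall_fin_two, isPairCard_of_mem hp, isPairCard_of_mem hq],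
      by simp [Fin.sum_univ_two, h]⟩
  | succ m hm ih =>
    obtain ⟨a, ha, h1, h2, h3⟩ : ∃ a ∈ ({4, 32} : Finset ℕ),
        a + 4 * m ≤ c ∧ c ≤ a + 32 * m ∧ c ≠ a + 4 * m + 1 := by
      by_cases h : c ≤ 4 + 32 * m
      · exact ⟨4, by simp, by omega, by omega, by omega⟩
      · exact ⟨32, by simp, by omega, by omega, by omega⟩
    obtain ⟨p, hp, hs⟩ := ih (c - a) (by omega) (by omega) (by omega)
    have ha' : IsPairCard a := isPairCard_of_mem (by
      simp only [Finset.mem_insert, Finset.mem_singleton] at ha ⊢; omega)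
    refine ⟨Fin.cons a p, Fin.cases (by simpa using ha') (by simpa using hp), ?_⟩
    rw [Fin.sum_univ_succ]
    simp only [Fin.cons_zero, Fin.cons_succ, hs]
    omega

/-- A phase factor on the second coordinate. -/
def phaseTwist (k : ℕ) (y : Qubits) : ℂ :=
  if y = (0, 1) then (1 + k * Complex.I) / (√(1 + (k : ℝ) ^ 2) : ℝ) else 1

lemma conj_phaseTwist_mul (k : ℕ) (y : Qubits) :
    (starRingEnd ℂ) (phaseTwist k y) * phaseTwist k y = 1 := by
  unfold phaseTwist
  split_ifs
  · have h : (0 : ℝ) < 1 + (k : ℝ) ^ 2 := by positivity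
    have hs : ((√(1 + (k : ℝ) ^ 2) : ℝ) : ℂ) * (√(1 + (k : ℝ) ^ 2) : ℝ) = 1 + (k : ℂ) ^ 2 := by
      rw [← Complex.ofReal_mul, Real.mul_self_sqrt h.le]; push_cast; rfl
    have hne : ((√(1 + (k : ℝ) ^ 2) : ℝ) : ℂ) ≠ 0 := by
      exact_mod_cast (Real.sqrt_pos.2 h).ne'
    simp only [map_div₀, map_add, map_one, map_mul, Complex.conj_I, Complex.conj_ofReal,
      map_natCast]
    rw [div_mul_div_comm, hs, div_eq_one_iff_eq (by rw [← hs]; exact mul_ne_zero hne hne)]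
    linear_combination -(k : ℂ) ^ 2 * Complex.I_sq
  · simp

/-- The squared length of a rational vector, as a real number. -/
def realNormSq (q : Qubits → ℚ) : ℝ := (ratDot q q : ℚ)

lemma realNormSq_pos {q : Qubits → ℚ} (hq : q (0, 0) = 1) : 0 < realNormSq q := by
  have : 0 < ratDot q q := by
    refine Finset.sum_pos' (fun y _ => mul_self_nonneg _) ⟨(0, 0), by simp, by simp [hq]⟩
  exact Rat.cast_pos.2 this

/-- The unit vector `|X⟩ ⊗ q / ‖q‖` with its coordinates twisted by phases. -/
def siteVec {m : ℕ} (X : Fin m) (k : ℕ) (q : Qubits → ℚ) :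
    EuclideanSpace ℂ (Fin m × Qubits) :=
  WithLp.toLp 2 fun p =>
    if p.1 = X then phaseTwist k p.2 * ((q p.2 : ℂ) / (√(realNormSq q) : ℝ)) else 0

lemma inner_siteVec_of_ne {m : ℕ} {X Y : Fin m} (h : X ≠ Y) (k l : ℕ) (q s : Qubits → ℚ) :
    inner ℂ (siteVec X k q) (siteVec Y l s) = 0 := by
  rw [PiLp.inner_apply]
  refine Finset.sum_eq_zero fun p _ => ?_
  by_cases hX : p.1 = X
  · simp [siteVec, show p.1 ≠ Y from fun hY => h (hX ▸ hY)]
  · simp [siteVec, hX]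

lemma inner_siteVec_same {m : ℕ} (X : Fin m) (k : ℕ) (q s : Qubits → ℚ) :
    inner ℂ (siteVec X k q) (siteVec X k s) =
      (ratDot q s : ℂ) / ((√(realNormSq q) : ℝ) * (√(realNormSq s) : ℝ)) := by
  rw [PiLp.inner_apply, Fintype.sum_prod_type, Finset.sum_eq_single X]
  · rw [ratDot, Rat.cast_sum, Finset.sum_div]
    refine Finset.sum_congr rfl fun y _ => ?_
    simp only [siteVec, if_true, RCLike.inner_apply, map_mul, map_div₀, Complex.conj_ofReal,
      map_ratCast, Rat.cast_mul]
    linear_combination ((s y : ℂ) / (√(realNormSq s) : ℝ) * ((q y : ℂ) / (√(realNormSq q) : ℝ))) *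
      conj_phaseTwist_mul k y
  · intro Y _ hY
    simp [siteVec, hY]
  · simp

lemma norm_siteVec {m : ℕ} (X : Fin m) (k : ℕ) {q : Qubits → ℚ} (hq : q (0, 0) = 1) :
    ‖siteVec X k q‖ = 1 := by
  have h := realNormSq_pos hq
  have h1 : inner ℂ (siteVec X k q) (siteVec X k q) = (1 : ℂ) := by
    rw [inner_siteVec_same, ← Complex.ofReal_mul, Real.mul_self_sqrt h.le]
    rw [realNormSq, Complex.ofReal_ratCast]
    refine div_self ?_
    rw [realNormSq] at h
    exact_mod_cast h.ne'
  rw [inner_self_eq_norm_sq_to_K] at h1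
  have h2 : ‖siteVec X k q‖ ^ 2 = 1 := Complex.ofReal_injective (by simpa using h1)
  exact (pow_eq_one_iff_of_nonneg (norm_nonneg _) two_ne_zero).1 h2

lemma siteVec_injective_of_phaseEq {m : ℕ} {X Y : Fin m} {k l : ℕ} {q s : Qubits → ℚ}
    (hq : q (0, 0) = 1) (hs : s (0, 0) = 1) (hq' : q (0, 1) ≠ 0)
    (h : PhaseEq (siteVec X k q) (siteVec Y l s)) : X = Y ∧ k = l ∧ q = s := by
  obtain ⟨θ, h⟩ := h
  have hqp := Real.sqrt_pos.2 (realNormSq_pos hq)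
  have hsp := Real.sqrt_pos.2 (realNormSq_pos hs)
  have hqne : ((√(realNormSq q) : ℝ) : ℂ) ≠ 0 := by exact_mod_cast hqp.ne'
  have hsne : ((√(realNormSq s) : ℝ) : ℂ) ≠ 0 := by exact_mod_cast hsp.ne'
  have hc : ∀ y, siteVec X k q (X, y) = Complex.exp (θ * Complex.I) * siteVec Y l s (X, y) :=
    fun y => by rw [h]; rfl
  have hX : X = Y := by
    by_contra hne
    have := hc (0, 0)
    simp [siteVec, hne, hq, phaseTwist, hqne] at this
  subst hX
  simp only [siteVec, if_true] at hc
  have h0 := hc (0, 0)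
  simp only [phaseTwist, hq, hs, Prod.mk.injEq, zero_ne_one, and_false, if_false, one_mul,
    Rat.cast_one] at h0
  have hnorm : √(realNormSq q) = √(realNormSq s) := by
    have := congrArg norm h0
    rw [norm_mul, Complex.norm_exp_ofReal_mul_I, one_mul, norm_div, norm_div,
      Complex.norm_of_nonneg hqp.le, Complex.norm_of_nonneg hsp.le, norm_one] at this
    simpa using this
  have hexp : Complex.exp (θ * Complex.I) = 1 := by
    rw [hnorm] at h0
    exact (mul_eq_right₀ (div_ne_zero one_ne_zero hsne)).1 h0.symm
  have hy : ∀ y, phaseTwist k y * (q y : ℂ) = phaseTwist l y * (s y : ℂ) := fun y => by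
    have := hc y
    rw [hexp, one_mul, hnorm, ← mul_div_assoc, ← mul_div_assoc] at this
    exact (div_left_inj' hsne).1 this
  have h1 := hy (0, 1)
  simp only [phaseTwist, if_true] at h1
  have hk := Real.sqrt_pos.2 (show (0 : ℝ) < 1 + (k : ℝ) ^ 2 by positivity)
  have hl := Real.sqrt_pos.2 (show (0 : ℝ) < 1 + (l : ℝ) ^ 2 by positivity)
  have hform : ∀ (n : ℕ) (r : ℝ) (a : ℚ), (1 + (n : ℂ) * Complex.I) / (r : ℂ) * (a : ℂ) =
      ⟨(a : ℝ) / r, n * ((a : ℝ) / r)⟩ := fun n r a => by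
    rw [Complex.mk_eq_add_mul_I]; push_cast; ring
  rw [hform, hform, Complex.mk.injEq] at h1
  have hkl : k = l := by
    have h2 := h1.2
    rw [← h1.1] at h2
    have := mul_right_cancel₀ (div_ne_zero (by exact_mod_cast hq') hk.ne') h2
    exact_mod_cast this
  subst hkl
  refine ⟨rfl, rfl, funext fun y => ?_⟩
  have hne : phaseTwist k y ≠ 0 := right_ne_zero_of_mul_eq_one (conj_phaseTwist_mul k y)
  exact_mod_cast mul_left_cancel₀ hne (hy y)

lemma famCardEq_of_key {ι κ E : Type*} [AddCommGroup E] [Module ℂ E] {f : ι → E} (key : ι → κ)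
    (S : Finset κ) (g : κ → E) (hf : ∀ i, f i = g (key i)) (hmem : ∀ i, key i ∈ S)
    (hsurj : ∀ s ∈ S, ∃ i, key i = s)
    (hinj : ∀ i j, PhaseEq (f i) (f j) → key i = key j) : FamCardEq f S.card := by
  refine ⟨fun k => g (S.equivFin.symm k), fun i => ⟨S.equivFin ⟨key i, hmem i⟩, ?_⟩,
    fun k => ?_, fun k l hkl h => hkl ?_⟩
  · simpa [hf] using PhaseEq.refl _
  · obtain ⟨i, hi⟩ := hsurj _ (S.equivFin.symm k).2
    exact ⟨i, by rw [hf, hi]; exact PhaseEq.refl _⟩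
  · obtain ⟨i, hi⟩ := hsurj _ (S.equivFin.symm k).2
    obtain ⟨j, hj⟩ := hsurj _ (S.equivFin.symm l).2
    have := hinj i j (by rw [hf, hf, hi, hj]; exact h)
    exact S.equivFin.symm.injective (Subtype.ext (hi.symm.trans (this.trans hj)))

/-- The block in position `K` among those of a symbol: a pair `A`, `B`, then `r` full blocks, and
copies of `A`. -/
def blockArray (A B : RatArray) (r K : ℕ) : RatArray :=
  if K = 1 then B else if 2 ≤ K ∧ K < 2 + r then projectivize (productArray true true) else A

/-- The twist of the block in position `K`. -/
def blockTwist (r K : ℕ) : ℕ := if 2 ≤ K ∧ K < 2 + r then K else 0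

/-- The twists and entries of all blocks of a symbol. -/
def blockKeys (A B : RatArray) (r : ℕ) : Finset (ℕ × (Qubits → ℚ)) :=
  {0} ×ˢ (entries A ∪ entries B) ∪
    Finset.Ico 2 (2 + r) ×ˢ entries (projectivize (productArray true true))

lemma card_blockKeys (A B : RatArray) (r : ℕ) :
    (blockKeys A B r).card = (entries A ∪ entries B).card + 16 * r := by
  rw [blockKeys, Finset.card_union_of_disjoint, Finset.card_product, Finset.card_product,
    card_entries_full, Finset.card_singleton, Nat.card_Ico]
  · omega
  · rw [Finset.disjoint_product]
    left
    simp

lemma isRatQLS_blockArray {A B : RatArray} (hA : IsRatQLS A) (hB : IsRatQLS B) (r K : ℕ) :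
    IsRatQLS (blockArray A B r K) := by
  unfold blockArray
  split_ifs
  exacts [hB, isRatQLS_full, hA]

lemma mem_entries {T : RatArray} {q : Qubits → ℚ} : q ∈ entries T ↔ ∃ a b, T a b = q := by
  simp [entries]

lemma mem_blockKeys (A B : RatArray) (r K : ℕ) (a b : Qubits) :
    (blockTwist r K, blockArray A B r K a b) ∈ blockKeys A B r := by
  have h : ∀ (T : RatArray), T a b ∈ entries T := fun T => mem_entries.2 ⟨a, b, rfl⟩
  unfold blockTwist blockArray blockKeys
  split_ifs
  · omega
  all_goals simp [*]

lemma exists_of_mem_blockKeys {m : ℕ} (hm : 2 ≤ m) {A B : RatArray} {r : ℕ} (hr : r ≤ m - 2)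
    {s : ℕ × (Qubits → ℚ)} (hs : s ∈ blockKeys A B r) :
    ∃ (K : Fin m) (a b : Qubits), (blockTwist r K, blockArray A B r K a b) = s := by
  obtain ⟨t, q⟩ := s
  simp only [blockKeys, Finset.mem_union, Finset.mem_product, Finset.mem_singleton,
    Finset.mem_Ico, mem_entries] at hs
  rcases hs with ⟨rfl, ⟨a, b, rfl⟩ | ⟨a, b, rfl⟩⟩ | ⟨ht, a, b, rfl⟩
  · exact ⟨⟨0, by omega⟩, a, b, by simp [blockTwist, blockArray]⟩
  · exact ⟨⟨1, by omega⟩, a, b, by simp [blockTwist, blockArray]⟩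
  · exact ⟨⟨t, by omega⟩, a, b, by simp [blockTwist, blockArray, ht, show t ≠ 1 by omega]⟩

lemma exists_qls_of_blocks {m : ℕ} (hm : 2 ≤ m) (A B : Fin m → RatArray) (r : Fin m → ℕ)
    (hA : ∀ X, IsRatQLS (A X)) (hB : ∀ X, IsRatQLS (B X)) (hr : ∀ X, r X ≤ m - 2) :
    ∃ M : Fin (4 * m) → Fin (4 * m) → EuclideanSpace ℂ (Fin m × Qubits),
      IsQLSIdx M ∧ FamCardEq (fun p : Fin (4 * m) × Fin (4 * m) => M p.1 p.2)
        (∑ X, ((entries (A X) ∪ entries (B X)).card + 16 * r X)) := by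
  have : NeZero m := ⟨by omega⟩
  let e : Fin (4 * m) ≃ Fin m × Qubits := Fintype.equivOfCardEq (by simp; omega)
  let key : Fin (4 * m) × Fin (4 * m) → Σ _ : Fin m, ℕ × (Qubits → ℚ) := fun p =>
    ⟨(e p.1).1 + (e p.2).1, blockTwist (r ((e p.1).1 + (e p.2).1)) (e p.1).1,
      blockArray (A ((e p.1).1 + (e p.2).1)) (B ((e p.1).1 + (e p.2).1))
        (r ((e p.1).1 + (e p.2).1)) (e p.1).1 (e p.1).2 (e p.2).2⟩
  let g : (Σ _ : Fin m, ℕ × (Qubits → ℚ)) → EuclideanSpace ℂ (Fin m × Qubits) :=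
    fun s => siteVec s.1 s.2.1 s.2.2
  have hblock X K : IsRatQLS (blockArray (A X) (B X) (r X) K) :=
    isRatQLS_blockArray (hA X) (hB X) _ _
  have hsame : ∀ (X : Fin m) (k : ℕ) (q s : Qubits → ℚ), ratDot q s = 0 →
      inner ℂ (siteVec X k q) (siteVec X k s) = 0 := fun X k q s h => by
    rw [inner_siteVec_same, h]; simp
  refine ⟨fun i j => g (key (i, j)), ⟨fun i => ⟨fun j => norm_siteVec _ _ ((hblock _ _).first _ _),
    fun j j' hj => ?_⟩, fun j => ⟨fun i => norm_siteVec _ _ ((hblock _ _).first _ _),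
    fun i i' hi => ?_⟩⟩, ?_⟩
  · have hne : e j ≠ e j' := e.injective.ne hj
    by_cases h : (e j).1 = (e j').1
    · simp only [g, key, ← h]
      exact hsame _ _ _ _ ((hblock _ _).row _ _ _ fun h' => hne (Prod.ext h h'))
    · exact inner_siteVec_of_ne (fun h' => h (add_left_cancel h')) _ _ _ _
  · have hne : e i ≠ e i' := e.injective.ne hi
    by_cases h : (e i).1 = (e i').1
    · simp only [g, key, ← h]
      exact hsame _ _ _ _ ((hblock _ _).col _ _ _ fun h' => hne (Prod.ext h h'))
    · exact inner_siteVec_of_ne (fun h' => h (add_right_cancel h')) _ _ _ _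
  · have hcard : (Finset.univ.sigma fun X => blockKeys (A X) (B X) (r X)).card =
        ∑ X, ((entries (A X) ∪ entries (B X)).card + 16 * r X) := by
      simp only [Finset.card_sigma, card_blockKeys]
    rw [← hcard]
    refine famCardEq_of_key key _ g (fun _ => rfl) (fun p => ?_) ?_ fun p p' h => ?_
    · exact Finset.mem_sigma.2 ⟨Finset.mem_univ _, mem_blockKeys _ _ _ _ _ _⟩
    · rintro ⟨X, s⟩ hs
      obtain ⟨K, a, b, h⟩ := exists_of_mem_blockKeys hm (hr X) (Finset.mem_sigma.1 hs).2
      exact ⟨(e.symm (K, a), e.symm (X - K, b)), by simpa [key] using h⟩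
    · obtain ⟨hX, hk, hq⟩ := siteVec_injective_of_phaseEq ((hblock _ _).first _ _)
        ((hblock _ _).first _ _) ((hblock _ _).second _ _) h
      exact Sigma.ext hX (heq_of_eq (Prod.ext hk hq))

/-- Main theorem: for any integer `m ≥ 2` and any integer `c` with
`4m ≤ c ≤ 16m²` and `c ≠ 4m + 1`, there is a quantum Latin square of order
`4m` over `ℋ_m ⊗ ℋ₂ ⊗ ℋ₂` with cardinality exactly `c`. -/
theorem exists_qls4m_all_cardinalities (m : ℕ) (hm : 2 ≤ m)
    (c : ℕ) (hlo : 4 * m ≤ c) (hhi : c ≤ 16 * m ^ 2) (hne : c ≠ 4 * m + 1) :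
    ∃ M : Fin (4 * m) → Fin (4 * m) → EuclideanSpace ℂ (Fin m × Fin 2 × Fin 2),
      IsQLSIdx M ∧ FamCardEq (fun p : Fin (4 * m) × Fin (4 * m) => M p.1 p.2) c := by
  obtain ⟨R, hR, h1, h2, h3⟩ : ∃ R ≤ m * (m - 2),
      4 * m + 16 * R ≤ c ∧ c ≤ 32 * m + 16 * R ∧ c ≠ 4 * m + 1 + 16 * R := by
    obtain ⟨n, rfl⟩ := Nat.exists_eq_add_of_le' hm
    have hsq : 16 * (n + 2) ^ 2 = 16 * ((n + 2) * n) + 32 * (n + 2) := by ring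
    rw [Nat.add_sub_cancel]
    exact ⟨(c - 32 * (n + 2) + 15) / 16, by omega, by omega, by omega, by omega⟩
  obtain ⟨p, hp, hps⟩ := exists_pairCard_sum m hm (c - 16 * R) (by omega) (by omega) (by omega)
  obtain ⟨r, hr, hrs⟩ := exists_sum_eq_of_le m (m - 2) R hR
  choose A B hA hB hAB using hp
  have hc : ∑ X, ((entries (A X) ∪ entries (B X)).card + 16 * r X) = c := by
    simp only [hAB, Finset.sum_add_distrib, ← Finset.mul_sum, hps, hrs]
    omega
  rw [← hc]
  exact exists_qls_of_blocks hm A B r hA hB hr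
end
end
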